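/- There exist a nonempty compact metrizable topological space X and continuous maps σ_1, σ_2, σ_3, σ_4 : X → X and τ_1, τ_2, τ_3, τ_4 : X → X such that the 4-variable dynamical systems (X, σ) and (X, τ) are piecewise equivalent, yet there exists no unitary equivalence between (X, σ) and (X, τ). -/

import Mathlib

open Set Equiv

/-- A nowhere vanishing continuous function on a contractible set has a continuous logarithm. -/
theorem exists_continuousOn_exp_eq {A : Type*} [TopologicalSpace A] {R : Set A}
    [ContractibleSpace R] {f : A → ℂ} (hf : ContinuousOn f R) (h0 : ∀ x ∈ R, f x ≠ 0) :
    ∃ F : A → ℂ, ContinuousOn F R ∧ ∀ x ∈ R, Complex.exp (F x) = f x := by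
  classical
  obtain ⟨x₀, ⟨H⟩⟩ := id_nullhomotopic R
  let f' : C(R, {z : ℂ // z ≠ 0}) :=
    ⟨fun x => ⟨f x, h0 x x.2⟩, (continuousOn_iff_continuous_domRestrict.1 hf).subtype_mk _⟩
  have hf' : ∀ x, (f' x : ℂ) = f x := fun _ => rfl
  let K : C(unitInterval × R, {z : ℂ // z ≠ 0}) := f'.comp (H.symm : C(unitInterval × R, R))
  have hK : ∀ a, K (0, a) =
      (⟨_, Complex.exp_ne_zero (Complex.log (f x₀))⟩ : {z : ℂ // z ≠ 0}) := by
    intro a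
    apply Subtype.ext
    simp [K, hf', Complex.exp_log (h0 x₀ x₀.2)]
  let G := Complex.isCoveringMap_exp.liftHomotopy K (ContinuousMap.const _ (Complex.log (f x₀))) hK
  have hG : ∀ x, Complex.exp (G (1, x)) = f x := by
    intro x
    have h := congrArg Subtype.val (congrFun (Complex.isCoveringMap_exp.liftHomotopy_lifts K
      (ContinuousMap.const _ (Complex.log (f x₀))) hK) (1, x))
    exact h.trans (by simp [K, hf'])
  refine ⟨fun x => if h : x ∈ R then G (1, ⟨x, h⟩) else 0, ?_, ?_⟩
  · rw [continuousOn_iff_continuous_domRestrict]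
    have : R.domRestrict (fun x => if h : x ∈ R then G (1, ⟨x, h⟩) else 0) =
        fun x => G (1, x) := by
      ext x; simp
    rw [this]
    fun_prop
  · intro x hx
    simp [hx, hG]

theorem eq_of_exp_comp_const {f : ℝ → ℂ} (hf : Continuous f) {c : ℂ}
    (h : ∀ t, Complex.exp (f t) = c) (s t : ℝ) : f s = f t := by
  refine Complex.isCoveringMap_exp.const_of_comp hf (fun a a' => Subtype.ext ?_) s t
  simp [h]

theorem det_fin_four_of_block {N : Matrix (Fin 4) (Fin 4) ℂ} {a b c d : Fin 4} (π : Perm (Fin 4))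
    (ha : π 0 = a) (hb : π 1 = b) (hc : π 2 = c) (hd : π 3 = d)
    (hN : ∀ j k, ¬ (j ∈ ({a, b} : Set (Fin 4)) ↔ k ∈ ({a, b} : Set (Fin 4))) → N j k = 0) :
    N.det = (N a a * N b b - N a b * N b a) * (N c c * N d d - N c d * N d c) := by
  rw [← Matrix.det_submatrix_equiv_self π N, Matrix.det_succ_row_zero]
  have hac : a ≠ c := by rw [← ha, ← hc]; simp
  have had : a ≠ d := by rw [← ha, ← hd]; simp
  have hbc : b ≠ c := by rw [← hb, ← hc]; simp
  have hbd : b ≠ d := by rw [← hb, ← hd]; simp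
  have h1 : N a c = 0 := hN _ _ (by simp [hac.symm, hbc.symm])
  have h2 : N a d = 0 := hN _ _ (by simp [had.symm, hbd.symm])
  have h3 : N b c = 0 := hN _ _ (by simp [hac.symm, hbc.symm])
  have h4 : N b d = 0 := hN _ _ (by simp [had.symm, hbd.symm])
  simp [Fin.sum_univ_succ, Matrix.det_fin_three, Fin.succAbove, ha, hb, hc, hd, h1, h2, h3, h4]
  ring

/-- Pairs of four points of the cube `[0, 1]⁴` and a probability vector on `S₄`. -/
abbrev Ambient : Type := (Fin 4 → Fin 4 → ℝ) × (Perm (Fin 4) → ℝ)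

/-- The points `(s, p)` such that any two permutations charged by `p` rearrange the four points
`s` in the same way. -/
def carrier : Set Ambient :=
  {x | (∀ i k, x.1 i k ∈ Icc (0 : ℝ) 1) ∧ x.2 ∈ stdSimplex ℝ (Perm (Fin 4)) ∧
    ∀ g h i k, x.2 g * x.2 h * (x.1 (g⁻¹ i) k - x.1 (h⁻¹ i) k) = 0}

theorem isCompact_carrier : IsCompact carrier := by
  have hK : IsCompact ((Set.pi univ fun _ : Fin 4 => Set.pi univ fun _ : Fin 4 => Icc (0 : ℝ) 1) ×ˢ
      stdSimplex ℝ (Perm (Fin 4))) :=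
    (isCompact_univ_pi fun _ => isCompact_univ_pi fun _ => isCompact_Icc).prod
      (isCompact_stdSimplex ℝ _)
  have hC : IsClosed {x : Ambient |
      ∀ g h i k, x.2 g * x.2 h * (x.1 (g⁻¹ i) k - x.1 (h⁻¹ i) k) = 0} := by
    simp only [ofPred_forall]
    exact isClosed_iInter fun g => isClosed_iInter fun h => isClosed_iInter fun i =>
      isClosed_iInter fun k => isClosed_eq (by fun_prop) continuous_const
  have h := hK.inter_right hC
  convert h using 1
  ext x
  simp only [carrier, mem_inter_iff, mem_prod, Set.mem_pi, mem_univ, true_imp_iff, mem_ofPred_eq,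
    and_assoc]

theorem const_mem_carrier {r : Fin 4 → ℝ} (hr : ∀ k, r k ∈ Icc (0 : ℝ) 1) :
    ((fun _ => r, Pi.single 1 1) : Ambient) ∈ carrier :=
  ⟨fun _ k => hr k, single_mem_stdSimplex ℝ _, fun _ _ _ _ => by simp⟩

theorem exists_ne_zero_of_mem_carrier {x : Ambient} (hx : x ∈ carrier) : ∃ g, x.2 g ≠ 0 := by
  by_contra! h
  have := hx.2.1.2
  simp [h] at this

theorem row_eq_of_mem_carrier {x : Ambient} (hx : x ∈ carrier) {g h : Perm (Fin 4)}
    (hg : x.2 g ≠ 0) (hh : x.2 h ≠ 0) (i : Fin 4) : x.1 (g⁻¹ i) = x.1 (h⁻¹ i) := by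
  ext k
  have := hx.2.2 g h i k
  simpa [hg, hh, sub_eq_zero] using this

/-- The rearranged points `t`: `t i = s (g⁻¹ i)` for each permutation `g` charged by `p`. -/
def rearranged (x : Ambient) (i k : Fin 4) : ℝ := ∑ g, x.2 g * x.1 (g⁻¹ i) k

theorem rearranged_eq {x : Ambient} (hx : x ∈ carrier) {g : Perm (Fin 4)} (hg : x.2 g ≠ 0)
    (i : Fin 4) : rearranged x i = x.1 (g⁻¹ i) := by
  ext k
  have : ∀ h, x.2 h * x.1 (h⁻¹ i) k = x.2 h * x.1 (g⁻¹ i) k := by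
    intro h
    by_cases hh : x.2 h = 0
    · simp [hh]
    · rw [row_eq_of_mem_carrier hx hg hh]
  simp only [rearranged, this]
  rw [← Finset.sum_mul, hx.2.1.2, one_mul]

/-- The part of `carrier` where every charged permutation maps `B` to `C`, and the points indexed
by `B` and by its complement lie on complementary faces of the cube. -/
def region (B C : Set (Fin 4)) : Set Ambient :=
  {x | x ∈ carrier ∧ (∀ g, x.2 g ≠ 0 → ∀ j, g j ∈ C ↔ j ∈ B) ∧ (∀ j, x.1 j j = 1) ∧
    ∀ j k, ¬ (j ∈ B ↔ k ∈ B) → x.1 j k = 0}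

theorem contractibleSpace_region {B C : Set (Fin 4)} {g₀ : Perm (Fin 4)}
    (hg₀ : ∀ j, g₀ j ∈ C ↔ j ∈ B) : ContractibleSpace (region B C) := by
  classical
  let b : Fin 4 → Fin 4 → ℝ := fun j k => if j ∈ B ↔ k ∈ B then 1 else 0
  have hb : ∀ j j' k, (j ∈ B ↔ j' ∈ B) → b j k = b j' k := by
    intro j j' k h
    simp only [b, h]
  have hb01 : ∀ j k, b j k ∈ Icc (0 : ℝ) 1 := by
    intro j k
    simp only [b]; split_ifs <;> simp
  let α : ℝ → ℝ := fun t => min 1 (2 * t)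
  let β : ℝ → ℝ := fun t => max 0 (2 * t - 1)
  let H : ℝ → Ambient → Ambient := fun t x =>
    (fun j k => (1 - α t) * x.1 j k + α t * b j k,
      (1 - β t) • x.2 + β t • Pi.single g₀ 1)
  have hmem : ∀ t ∈ Icc (0 : ℝ) 1, ∀ x ∈ region B C, H t x ∈ region B C := by
    intro t ht x hx
    have hα : α t ∈ Icc (0 : ℝ) 1 := ⟨le_min zero_le_one (by linarith [ht.1]), min_le_left _ _⟩
    have hβ : β t ∈ Icc (0 : ℝ) 1 := ⟨le_max_left _ _, max_le zero_le_one (by linarith [ht.2])⟩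
    have hαβ : β t = 0 ∨ α t = 1 := by
      rcases le_total (2 * t) 1 with h | h
      · left; exact max_eq_left (by linarith)
      · right; exact min_eq_left h
    have hsupp : ∀ g, (H t x).2 g ≠ 0 → ∀ j, g j ∈ C ↔ j ∈ B := by
      intro g hg
      by_cases h1 : x.2 g = 0
      · by_cases h2 : g = g₀
        · exact h2 ▸ hg₀
        · simp [H, h1, h2] at hg
      · exact hx.2.1 g h1
    have hinv : ∀ g, (H t x).2 g ≠ 0 → ∀ i, g⁻¹ i ∈ B ↔ i ∈ C := by
      intro g hg i
      simpa using (hsupp g hg (g⁻¹ i)).symm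
    refine ⟨⟨fun i k => ?_, ?_, fun g h i k => ?_⟩, hsupp, fun j => ?_, fun j k hjk => ?_⟩
    · exact (convex_Icc (0 : ℝ) 1) (hx.1.1 i k) (hb01 i k) (by linarith [hα.2]) hα.1 (by ring)
    · exact (convex_stdSimplex ℝ _) hx.1.2.1 (single_mem_stdSimplex ℝ _) (by linarith [hβ.2]) hβ.1
        (by ring)
    · by_cases hg : (H t x).2 g = 0
      · simp [hg]
      by_cases hh : (H t x).2 h = 0
      · simp [hh]
      have hbb : b (g⁻¹ i) k = b (h⁻¹ i) k := hb _ _ _ ((hinv g hg i).trans (hinv h hh i).symm)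
      rcases hαβ with h0 | h1
      · have := hx.1.2.2 g h i k
        simp only [H, hbb, h0]
        simp only [sub_zero, one_smul, zero_smul, add_zero]
        linear_combination (1 - α t) * this
      · simp only [H, hbb, h1]
        ring
    · simp [H, b, hx.2.2.1 j]
    · simp [H, b, hjk, hx.2.2.2 j k hjk]
  have hcont : Continuous fun y : ℝ × Ambient => H y.1 y.2 := by
    simp only [H, α, β]
    fun_prop
  have h0 : ∀ x, H 0 x = x := by
    intro x
    ext <;> simp [H, α, β]
  have h1 : ∀ x, H 1 x = (b, Pi.single g₀ 1) := by
    intro x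
    have e1 : α 1 = 1 := by norm_num [α]
    have e2 : β 1 = 1 := by norm_num [β]
    ext <;> simp [H, e1, e2]
  have hne : ((b, Pi.single g₀ 1) : Ambient) ∈ region B C := by
    refine ⟨⟨hb01, single_mem_stdSimplex ℝ _, fun g h i k => ?_⟩, fun g hg => ?_, ?_, ?_⟩
    · by_cases h1 : g = g₀
      · by_cases h2 : h = g₀
        · simp [h1, h2]
        · simp [h2]
      · simp [h1]
    · by_cases h2 : g = g₀
      · exact h2 ▸ hg₀
      · simp [h2] at hg
    · intro j; simp [b]
    · intro j k h; simp [b, h]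
  refine (contractible_iff_id_nullhomotopic _).2 ⟨⟨_, hne⟩, ⟨⟨⟨fun y =>
    ⟨H y.1 y.2, hmem _ y.1.2 _ y.2.2⟩, ?_⟩, fun x => ?_, fun x => ?_⟩⟩⟩
  · exact Continuous.subtype_mk 
      (hcont.comp (f := fun y : unitInterval × region B C => ((y.1 : ℝ), (y.2 : Ambient)))
        (by fun_prop)) _
  · exact Subtype.ext (h0 x)
  · exact Subtype.ext (h1 x)

/-- The point of `carrier` over the coordinate vectors of the cube with permutation `g`. -/
def vertex (g : Perm (Fin 4)) : Ambient := (fun j k => if j = k then 1 else 0, Pi.single g 1)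

/-- A path from `vertex g` to `vertex (g * swap a b)` along which only the points `a` and `b` are
merged. -/
noncomputable def edge (g : Perm (Fin 4)) (a b : Fin 4) (t : ℝ) : Ambient :=
  (fun j k => if j = k then 1 else if k = swap a b j then max 0 (min 1 (min t (3 - t))) else 0,
    (1 - max 0 (min 1 (t - 1))) • Pi.single g 1 +
      max 0 (min 1 (t - 1)) • Pi.single (g * swap a b) 1)

theorem edge_zero (g : Perm (Fin 4)) (a b : Fin 4) : edge g a b 0 = vertex g := by
  ext <;> simp [edge, vertex]

theorem edge_three (g : Perm (Fin 4)) (a b : Fin 4) :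
    edge g a b 3 = vertex (g * swap a b) := by
  have : (1 : ℝ) ≤ 3 - 1 := by norm_num
  ext <;> simp [edge, vertex, this]

theorem continuous_edge (g : Perm (Fin 4)) (a b : Fin 4) : Continuous (edge g a b) := by
  unfold edge
  refine Continuous.prodMk ?_ (by fun_prop)
  refine continuous_pi fun j => continuous_pi fun k => ?_
  split_ifs <;> fun_prop

theorem edge_mem_region {B C : Set (Fin 4)} {g : Perm (Fin 4)} (hg : ∀ j, g j ∈ C ↔ j ∈ B)
    {a b : Fin 4} (hab : a ∈ B ↔ b ∈ B) (t : ℝ) : edge g a b t ∈ region B C := by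
  set m : ℝ := max 0 (min 1 (min t (3 - t))) with hm
  set q : ℝ := max 0 (min 1 (t - 1)) with hq
  have hm01 : m ∈ Icc (0 : ℝ) 1 := ⟨le_max_left _ _, max_le zero_le_one (min_le_left _ _)⟩
  have hq01 : q ∈ Icc (0 : ℝ) 1 := ⟨le_max_left _ _, max_le zero_le_one (min_le_left _ _)⟩
  have hmq : q = 0 ∨ q = 1 ∨ m = 1 := by
    rcases le_total t 1 with h | h
    · left
      exact max_eq_left ((min_le_right _ _).trans (by linarith))
    rcases le_total 2 t with h' | h'
    · right; left
      rw [hq, min_eq_left (by linarith), max_eq_right zero_le_one]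
    · right; right
      rw [hm, min_eq_left (le_min h (by linarith)), max_eq_right zero_le_one]
  have hswap : ∀ j, swap a b j ∈ B ↔ j ∈ B := by
    intro j
    rw [swap_apply_def]
    split_ifs with h1 h2
    · rw [h1, hab]
    · rw [h2, hab]
    · rfl
  have hedge : edge g a b t = (fun j k => if j = k then 1 else if k = swap a b j then m else 0,
    (1 - q) • Pi.single g 1 + q • Pi.single (g * swap a b) 1) := rfl
  have hsupp : ∀ h, (edge g a b t).2 h ≠ 0 → (h = g ∧ q ≠ 1) ∨ (h = g * swap a b ∧ q ≠ 0) := by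
    intro h hh
    rw [hedge] at hh
    by_contra! hcon
    apply hh
    by_cases h1 : h = g
    · by_cases h2 : h = g * swap a b
      · exact absurd ((hcon.1 h1).symm.trans (hcon.2 h2)) one_ne_zero
      · simp [h2, hcon.1 h1]
    · by_cases h2 : h = g * swap a b
      · simp [h1, hcon.2 h2]
      · simp [h1, h2]
  have hrow : m = 1 → ∀ j k, (edge g a b t).1 (swap a b j) k = (edge g a b t).1 j k := by
    intro h1 j k
    rw [hedge]
    simp only [h1, swap_apply_self]
    by_cases e1 : j = k
    · simp [e1]
    · by_cases e2 : swap a b j = k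
      · simp [e2]
      · simp [e1, e2, Ne.symm e1, Ne.symm e2]
  refine ⟨⟨fun j k => ?_, ?_, fun h h' i k => ?_⟩, fun h hh j => ?_, fun j => ?_, fun j k hjk => ?_⟩
  · rw [hedge]
    dsimp only
    split_ifs
    · simp
    · exact hm01
    · simp
  · exact (convex_stdSimplex ℝ _) (single_mem_stdSimplex ℝ _) (single_mem_stdSimplex ℝ _)
      (by linarith [hq01.2]) hq01.1 (by ring)
  · by_cases hh : (edge g a b t).2 h = 0
    · simp [hh]
    by_cases hh' : (edge g a b t).2 h' = 0
    · simp [hh']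
    have hrow' : q ≠ 0 → q ≠ 1 → ∀ j k, (edge g a b t).1 (swap a b j) k = (edge g a b t).1 j k :=
      fun h0 h1 => hrow ((hmq.resolve_left h0).resolve_left h1)
    rcases hsupp h hh with ⟨rfl, e⟩ | ⟨rfl, e⟩ <;> rcases hsupp h' hh' with ⟨rfl, e'⟩ | ⟨rfl, e'⟩
    · simp
    · simp [mul_inv_rev, hrow' e' e]
    · simp [mul_inv_rev, hrow' e e']
    · simp
  · rcases hsupp h hh with ⟨rfl, -⟩ | ⟨rfl, -⟩
    · exact hg j
    · rw [Perm.mul_apply, hg, hswap]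
  · simp [edge]
  · rw [hedge]
    have h1 : j ≠ k := by rintro rfl; exact hjk Iff.rfl
    have h2 : k ≠ swap a b j := by rintro rfl; exact hjk (hswap j).symm
    simp [h1, h2]

theorem vertex_mem_region {B C : Set (Fin 4)} {g : Perm (Fin 4)} (hg : ∀ j, g j ∈ C ↔ j ∈ B) :
    vertex g ∈ region B C := by
  rw [← edge_zero g 0 0]
  exact edge_mem_region hg Iff.rfl 0

theorem eq_of_exp_edge_const {F : Ambient → ℂ} {g : Perm (Fin 4)} {a b : Fin 4} {c : ℂ}
    (hF : Continuous fun t => F (edge g a b t))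
    (h : ∀ t, Complex.exp (F (edge g a b t)) = c) :
    F (vertex (g * swap a b)) = F (vertex g) := by
  simpa only [edge_zero, edge_three] using eq_of_exp_comp_const hF h 3 0

/-- A continuous family of invertible matrices on `carrier` whose entry at `(i, j)` vanishes unless
the `i`-th rearranged point equals the `j`-th point. -/
structure IsIntertwiner (U : Ambient → Matrix (Fin 4) (Fin 4) ℂ) : Prop where
  continuousOn : ∀ i j, ContinuousOn (fun x => U x i j) carrier
  det_ne_zero : ∀ x ∈ carrier, (U x).det ≠ 0
  row_eq : ∀ x ∈ carrier, ∀ g, x.2 g ≠ 0 → ∀ i j, U x i j ≠ 0 → x.1 (g⁻¹ i) = x.1 j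

namespace IsIntertwiner

variable {U : Ambient → Matrix (Fin 4) (Fin 4) ℂ}

theorem apply_eq_zero (hU : IsIntertwiner U) {B C : Set (Fin 4)} {g : Perm (Fin 4)}
    (hg : ∀ j, g j ∈ C ↔ j ∈ B) {x : Ambient} (hx : x ∈ region B C) {j k : Fin 4}
    (hjk : ¬ (j ∈ B ↔ k ∈ B)) : U x (g j) k = 0 := by
  by_contra h0
  obtain ⟨h, hh⟩ := exists_ne_zero_of_mem_carrier hx.1
  have hrow := congrFun (hU.row_eq x hx.1 h hh _ _ h0) k
  have hB : h⁻¹ (g j) ∈ B ↔ j ∈ B := by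
    rw [← hg j, ← hx.2.1 h hh]
    simp
  rw [hx.2.2.1 k, hx.2.2.2 _ _ (by rwa [hB])] at hrow
  exact zero_ne_one hrow

theorem continuousOn_region (hU : IsIntertwiner U) {B C : Set (Fin 4)} (i j : Fin 4) :
    ContinuousOn (fun x => U x i j) (region B C) :=
  (hU.continuousOn i j).mono fun _ hx => hx.1

theorem det_submatrix (g : Perm (Fin 4)) (x : Ambient) :
    ((U x).submatrix g id).det = (Perm.sign g : ℂ) * (U x).det :=
  Matrix.det_permute g (U x)

theorem det_submatrix_ne_zero (hU : IsIntertwiner U) (g : Perm (Fin 4)) {x : Ambient}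
    (hx : x ∈ carrier) : ((U x).submatrix g id).det ≠ 0 := by
  rw [det_submatrix]
  refine mul_ne_zero ?_ (hU.det_ne_zero x hx)
  rcases Int.units_eq_one_or (Perm.sign g) with h | h <;> simp [h]

theorem exists_log_det (hU : IsIntertwiner U) : ∃ D : Ambient → ℂ,
    ContinuousOn D (region univ univ) ∧
      ∀ x ∈ region univ univ, Complex.exp (D x) = (U x).det := by
  have := contractibleSpace_region (B := univ) (C := univ) (g₀ := 1) (by simp)
  refine exists_continuousOn_exp_eq ?_ fun x hx => hU.det_ne_zero x hx.1
  simp only [Matrix.det_apply]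
  exact continuousOn_finsetSum _ fun g _ => ContinuousOn.const_smul
    (continuousOn_finsetProd _ fun i _ => hU.continuousOn_region _ _) _

theorem exists_log_entry (hU : IsIntertwiner U) (j i : Fin 4) : ∃ A : Ambient → ℂ,
    ContinuousOn A (region {j} {i}) ∧
      ∀ x ∈ region {j} {i}, Complex.exp (A x) = U x i j := by
  have hg : ∀ k, swap i j k ∈ ({i} : Set (Fin 4)) ↔ k ∈ ({j} : Set (Fin 4)) := by
    intro k
    simp [swap_apply_eq_iff]
  have := contractibleSpace_region hg
  refine exists_continuousOn_exp_eq (hU.continuousOn_region i j) fun x hx h0 => ?_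
  refine hU.det_submatrix_ne_zero (swap i j) hx.1 (Matrix.det_eq_zero_of_row_eq_zero j fun k => ?_)
  by_cases hk : k = j
  · simp [hk, h0]
  · exact hU.apply_eq_zero hg hx (by simp [hk])

theorem det_submatrix_eq (hU : IsIntertwiner U) {a b c d : Fin 4} (π : Perm (Fin 4))
    (ha : π 0 = a) (hb : π 1 = b) (hc : π 2 = c) (hd : π 3 = d) {C : Set (Fin 4)}
    {g : Perm (Fin 4)} (hg : ∀ j, g j ∈ C ↔ j ∈ ({a, b} : Set (Fin 4)))
    {x : Ambient} (hx : x ∈ region {a, b} C) :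
    ((U x).submatrix g id).det = (U x (g a) a * U x (g b) b - U x (g a) b * U x (g b) a) *
      (U x (g c) c * U x (g d) d - U x (g c) d * U x (g d) c) :=
  det_fin_four_of_block π ha hb hc hd fun _ _ hjk => hU.apply_eq_zero hg hx hjk

theorem exists_log_minor (hU : IsIntertwiner U) {a b c d : Fin 4} (π : Perm (Fin 4))
    (ha : π 0 = a) (hb : π 1 = b) (hc : π 2 = c) (hd : π 3 = d) {C : Set (Fin 4)}
    {g : Perm (Fin 4)} (hg : ∀ j, g j ∈ C ↔ j ∈ ({a, b} : Set (Fin 4))) :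
    ∃ F : Ambient → ℂ, ContinuousOn F (region {a, b} C) ∧ ∀ x ∈ region {a, b} C,
      Complex.exp (F x) = U x (g a) a * U x (g b) b - U x (g a) b * U x (g b) a := by
  have := contractibleSpace_region hg
  refine exists_continuousOn_exp_eq ?_ fun x hx h0 => ?_
  · exact ((hU.continuousOn_region _ _).mul (hU.continuousOn_region _ _)).sub
      ((hU.continuousOn_region _ _).mul (hU.continuousOn_region _ _))
  · apply hU.det_submatrix_ne_zero g hx.1
    rw [hU.det_submatrix_eq π ha hb hc hd hg hx, h0, zero_mul]

variable {A : Fin 4 → Fin 4 → Ambient → ℂ} {D F : Ambient → ℂ}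

theorem log_minor_sub (hU : IsIntertwiner U)
    (hAc : ∀ j i, ContinuousOn (A j i) (region {j} {i}))
    (hA : ∀ j i, ∀ x ∈ region {j} {i}, Complex.exp (A j i x) = U x i j)
    {a b c d : Fin 4} (hab : a ≠ b) (hac : a ≠ c) (had : a ≠ d) (hbc : b ≠ c) (hbd : b ≠ d)
    {C : Set (Fin 4)} {g : Perm (Fin 4)} (hg : ∀ j, g j ∈ C ↔ j ∈ ({a, b} : Set (Fin 4)))
    (hFc : ContinuousOn F (region {a, b} C)) {ε : ℂ}
    (hF : ∀ x ∈ region {a, b} C, Complex.exp (F x) =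
      ε * (U x (g a) a * U x (g b) b - U x (g a) b * U x (g b) a)) :
    F (vertex (g * swap c d)) - A a (g a) (vertex (g * swap c d))
        - A b (g b) (vertex (g * swap c d)) =
      F (vertex g) - A a (g a) (vertex g) - A b (g b) (vertex g) := by
  have ha : ∀ j, g j ∈ ({g a} : Set (Fin 4)) ↔ j ∈ ({a} : Set (Fin 4)) := by simp
  have hb : ∀ j, g j ∈ ({g b} : Set (Fin 4)) ↔ j ∈ ({b} : Set (Fin 4)) := by simp
  have hea := edge_mem_region (a := c) (b := d) ha (by simp [hac.symm, had.symm])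
  have heb := edge_mem_region (a := c) (b := d) hb (by simp [hbc.symm, hbd.symm])
  have heC := edge_mem_region (a := c) (b := d) hg
    (by simp [hac.symm, had.symm, hbc.symm, hbd.symm])
  have he := continuous_edge g c d
  refine eq_of_exp_edge_const (F := fun x => F x - A a (g a) x - A b (g b) x) (c := ε)
    (((hFc.comp_continuous he heC).sub ((hAc _ _).comp_continuous he hea)).sub
      ((hAc _ _).comp_continuous he heb)) fun t => ?_
  have h0 : U (edge g c d t) (g a) b = 0 := hU.apply_eq_zero ha (hea t) (by simp [hab.symm])
  have h1 := hA _ _ _ (hea t)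
  have h2 := hA _ _ _ (heb t)
  rw [Complex.exp_sub, Complex.exp_sub, hF _ (heC t), h0, ← h1, ← h2]
  field_simp
  ring

theorem log_cominor_sub (hU : IsIntertwiner U)
    (hAc : ∀ j i, ContinuousOn (A j i) (region {j} {i}))
    (hA : ∀ j i, ∀ x ∈ region {j} {i}, Complex.exp (A j i x) = U x i j)
    (hDc : ContinuousOn D (region univ univ))
    (hD : ∀ x ∈ region univ univ, Complex.exp (D x) = (U x).det)
    {a b c d : Fin 4} (π : Perm (Fin 4))
    (ha : π 0 = a) (hb : π 1 = b) (hc : π 2 = c) (hd : π 3 = d)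
    {C : Set (Fin 4)} {g : Perm (Fin 4)} (hg : ∀ j, g j ∈ C ↔ j ∈ ({a, b} : Set (Fin 4)))
    (hFc : ContinuousOn F (region {a, b} C)) {ε : ℂ}
    (hF : ∀ x ∈ region {a, b} C, Complex.exp (F x) =
      ε * (U x (g a) a * U x (g b) b - U x (g a) b * U x (g b) a)) :
    D (vertex (g * swap a b)) - F (vertex (g * swap a b))
        - A c (g c) (vertex (g * swap a b)) - A d (g d) (vertex (g * swap a b)) =
      D (vertex g) - F (vertex g) - A c (g c) (vertex g) - A d (g d) (vertex g) := by
  have hca : c ≠ a := by rw [← ha, ← hc]; simp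
  have hcb : c ≠ b := by rw [← hb, ← hc]; simp
  have hda : d ≠ a := by rw [← ha, ← hd]; simp
  have hdb : d ≠ b := by rw [← hb, ← hd]; simp
  have hcd : c ≠ d := by rw [← hc, ← hd]; simp
  have hgc : ∀ j, g j ∈ ({g c} : Set (Fin 4)) ↔ j ∈ ({c} : Set (Fin 4)) := by simp
  have hgd : ∀ j, g j ∈ ({g d} : Set (Fin 4)) ↔ j ∈ ({d} : Set (Fin 4)) := by simp
  have hec := edge_mem_region (a := a) (b := b) hgc (by simp [hca.symm, hcb.symm])
  have hed := edge_mem_region (a := a) (b := b) hgd (by simp [hda.symm, hdb.symm])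
  have heC := edge_mem_region (a := a) (b := b) hg (by simp)
  have heu := edge_mem_region (g := g) (a := a) (b := b) (B := univ) (C := univ) (by simp) (by simp)
  have he := continuous_edge g a b
  have hs : ((Perm.sign g : ℤ) : ℂ) ≠ 0 := by exact_mod_cast (Perm.sign g).ne_zero
  refine eq_of_exp_edge_const
    (F := fun x => D x - F x - A c (g c) x - A d (g d) x) (c := ((Perm.sign g : ℤ) * ε : ℂ)⁻¹)
    ((((hDc.comp_continuous he heu).sub (hFc.comp_continuous he heC)).sub
      ((hAc _ _).comp_continuous he hec)).sub ((hAc _ _).comp_continuous he hed)) fun t => ?_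
  have h0 : U (edge g a b t) (g c) d = 0 := hU.apply_eq_zero hgc (hec t) (by simp [hcd.symm])
  have h1 := hA _ _ _ (hec t)
  have h2 := hA _ _ _ (hed t)
  have h3 := hF _ (heC t)
  have hdet := hU.det_submatrix_eq π ha hb hc hd hg (heC t)
  rw [det_submatrix, h0, ← h1, ← h2] at hdet
  have hε : ε ≠ 0 := by
    rintro rfl
    rw [zero_mul] at h3
    exact Complex.exp_ne_zero _ h3
  rw [Complex.exp_sub, Complex.exp_sub, Complex.exp_sub, hD _ (heu t)]
  have h3' := Complex.exp_ne_zero (F (edge g a b t))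
  field_simp
  rw [h3]
  linear_combination ε * hdet

/-- The logarithm of the sign of `g` obtained by comparing a logarithm `D` of the determinant with
logarithms `A j i` of the entries at `vertex g`. -/
def signLog (A : Fin 4 → Fin 4 → Ambient → ℂ) (D : Ambient → ℂ) (g : Perm (Fin 4)) : ℂ :=
  D (vertex g) - ∑ j, A j (g j) (vertex g)

theorem exp_signLog (hU : IsIntertwiner U)
    (hA : ∀ j i, ∀ x ∈ region {j} {i}, Complex.exp (A j i x) = U x i j)
    (hD : ∀ x ∈ region univ univ, Complex.exp (D x) = (U x).det) (g : Perm (Fin 4)) :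
    Complex.exp (signLog A D g) = (Perm.sign g : ℤ) := by
  have hv : ∀ j, vertex g ∈ region {j} {g j} := fun j => vertex_mem_region (by simp)
  have hdet := det_submatrix (U := U) g (vertex g)
  have hoff : ∀ j k, k ≠ j → U (vertex g) (g j) k = 0 := fun j k h =>
    hU.apply_eq_zero (B := {j}) (C := {g j}) (by simp) (hv j) (by simp [h])
  have hdiag : (U (vertex g)).submatrix g id =
      Matrix.diagonal fun j => U (vertex g) (g j) j := by
    ext j k
    by_cases h : k = j
    · simp [h]
    · simp [hoff j k h, Matrix.diagonal_apply_ne _ (Ne.symm h)]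
  rw [hdiag, Matrix.det_diagonal] at hdet
  rw [signLog, Complex.exp_sub, Complex.exp_sum, hD _ (vertex_mem_region (by simp)),
    Finset.prod_congr rfl fun j _ => hA j (g j) _ (hv j), hdet]
  have h0 := hU.det_ne_zero _ (hv 0).1
  rcases Int.units_eq_one_or (Perm.sign g) with h | h <;> simp [h, h0]

theorem signLog_square (hU : IsIntertwiner U)
    (hAc : ∀ j i, ContinuousOn (A j i) (region {j} {i}))
    (hA : ∀ j i, ∀ x ∈ region {j} {i}, Complex.exp (A j i x) = U x i j)
    (hDc : ContinuousOn D (region univ univ))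
    (hD : ∀ x ∈ region univ univ, Complex.exp (D x) = (U x).det)
    (π g : Perm (Fin 4)) {g₁ g₂ g₃ : Perm (Fin 4)} (hg₁ : g * swap (π 0) (π 1) = g₁)
    (hg₂ : g * swap (π 2) (π 3) = g₂) (hg₃ : g₁ * swap (π 2) (π 3) = g₃) :
    signLog A D g - signLog A D g₁ - signLog A D g₂ + signLog A D g₃ = 0 := by
  obtain ⟨a, ha⟩ : ∃ a, π 0 = a := ⟨_, rfl⟩
  obtain ⟨b, hb⟩ : ∃ b, π 1 = b := ⟨_, rfl⟩
  obtain ⟨c, hc⟩ : ∃ c, π 2 = c := ⟨_, rfl⟩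
  obtain ⟨d, hd⟩ : ∃ d, π 3 = d := ⟨_, rfl⟩
  have hab : a ≠ b := by rw [← ha, ← hb]; simp
  have hac : a ≠ c := by rw [← ha, ← hc]; simp
  have had : a ≠ d := by rw [← ha, ← hd]; simp
  have hbc : b ≠ c := by rw [← hb, ← hc]; simp
  have hbd : b ≠ d := by rw [← hb, ← hd]; simp
  have hcd : c ≠ d := by rw [← hc, ← hd]; simp
  have hsum : ∀ f : Fin 4 → ℂ, ∑ j, f j = f a + f b + f c + f d := by
    intro f
    rw [← Equiv.sum_comp π, Fin.sum_univ_four, ha, hb, hc, hd]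
  rw [ha, hb] at hg₁
  rw [hc, hd] at hg₂ hg₃
  have h1a : g₁ a = g b := by simp [← hg₁]
  have h1b : g₁ b = g a := by simp [← hg₁]
  have h1c : g₁ c = g c := by simp [← hg₁, swap_apply_of_ne_of_ne hac.symm hbc.symm]
  have h1d : g₁ d = g d := by simp [← hg₁, swap_apply_of_ne_of_ne had.symm hbd.symm]
  have h2a : g₂ a = g a := by simp [← hg₂, swap_apply_of_ne_of_ne hac had]
  have h2b : g₂ b = g b := by simp [← hg₂, swap_apply_of_ne_of_ne hbc hbd]
  have h2c : g₂ c = g d := by simp [← hg₂]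
  have h2d : g₂ d = g c := by simp [← hg₂]
  have h3a : g₃ a = g b := by simp [← hg₃, swap_apply_of_ne_of_ne hac had, h1a]
  have h3b : g₃ b = g a := by simp [← hg₃, swap_apply_of_ne_of_ne hbc hbd, h1b]
  have h3c : g₃ c = g d := by simp [← hg₃, h1d]
  have h3d : g₃ d = g c := by simp [← hg₃, h1c]
  have hg₃' : g₂ * swap a b = g₃ := by
    rw [← hg₃, ← hg₁, ← hg₂, mul_assoc, mul_assoc]
    congr 1
    exact (Perm.disjoint_swap_swap 
      (by simp [hab, hcd, hac.symm, had.symm, hbc.symm, hbd.symm])).commute.eq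
  have hC : ∀ j, g j ∈ g '' {a, b} ↔ j ∈ ({a, b} : Set (Fin 4)) := fun j =>
    g.injective.mem_set_image
  have hC₁ : ∀ j, g₁ j ∈ g '' {a, b} ↔ j ∈ ({a, b} : Set (Fin 4)) := by
    intro j
    rw [image_pair, ← h1a, ← h1b]
    simp [or_comm]
  have hC₂ : ∀ j, g₂ j ∈ g '' {a, b} ↔ j ∈ ({a, b} : Set (Fin 4)) := by
    intro j
    rw [image_pair, ← h2a, ← h2b]
    simp
  obtain ⟨F, hFc, hF⟩ := hU.exists_log_minor π ha hb hc hd hC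
  have e₁ := hU.log_minor_sub hAc hA hab hac had hbc hbd hC hFc (ε := 1)
    fun x hx => by rw [hF x hx, one_mul]
  have e₂ := hU.log_minor_sub hAc hA hab hac had hbc hbd hC₁ hFc (ε := -1)
    fun x hx => by rw [hF x hx, h1a, h1b]; ring
  have e₃ := hU.log_cominor_sub hAc hA hDc hD π ha hb hc hd hC hFc (ε := 1)
    fun x hx => by rw [hF x hx, one_mul]
  have e₄ := hU.log_cominor_sub hAc hA hDc hD π ha hb hc hd hC₂ hFc (ε := 1)
    fun x hx => by rw [hF x hx, h2a, h2b]; ring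
  rw [hg₂] at e₁
  rw [hg₃, h1a, h1b] at e₂
  rw [hg₁] at e₃
  rw [hg₃', h2c, h2d] at e₄
  simp only [signLog, hsum, h1a, h1b, h1c, h1d, h2a, h2b, h2c, h2d, h3a, h3b, h3c, h3d]
  linear_combination -e₁ + e₂ - e₃ + e₄

end IsIntertwiner

/-- A function on `S₄` whose alternating sums over the left cosets of `⟨(a b), (c d)⟩` vanish has
vanishing alternating sum over `S₃`. -/
theorem sum_even_eq_sum_odd_of_square {L : Perm (Fin 4) → ℂ}
    (hL : ∀ π g g₁ g₂ g₃ : Perm (Fin 4), g * swap (π 0) (π 1) = g₁ → g * swap (π 2) (π 3) = g₂ →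
      g₁ * swap (π 2) (π 3) = g₃ → L g - L g₁ - L g₂ + L g₃ = 0) :
    L 1 + L (swap 0 1 * swap 1 2) + L (swap 1 2 * swap 0 1) =
      L (swap 0 1) + L (swap 1 2) + L (swap 0 1 * swap 1 2 * swap 0 1) := by
  have h₁ := hL (swap 1 2) 1
    (swap 0 1 * swap 1 2 * swap 0 1)
    (swap 1 2 * swap 2 3 * swap 1 2)
    (swap 1 2 * swap 0 1 * swap 2 3 * swap 1 2)
    (by decide) (by decide) (by decide)
  have h₂ := hL (swap 0 1 * swap 1 2) 1
    (swap 1 2)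
    (swap 0 1 * swap 1 2 * swap 2 3 * swap 1 2 * swap 0 1)
    (swap 0 1 * swap 1 2 * swap 0 1 * swap 2 3 * swap 1 2 * swap 0 1)
    (by decide) (by decide) (by decide)
  have h₃ := hL (swap 1 2) (swap 0 1 * swap 1 2)
    (swap 1 2)
    (swap 0 1 * swap 2 3 * swap 1 2)
    (swap 2 3 * swap 1 2)
    (by decide) (by decide) (by decide)
  have h₄ := hL (swap 0 1 * swap 1 2) (swap 0 1 * swap 1 2)
    (swap 0 1)
    (swap 1 2 * swap 0 1 * swap 2 3 * swap 1 2 * swap 0 1)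
    (swap 1 2 * swap 2 3 * swap 1 2 * swap 0 1)
    (by decide) (by decide) (by decide)
  have h₅ := hL (swap 1 2) (swap 1 2 * swap 0 1)
    (swap 0 1)
    (swap 0 1 * swap 1 2 * swap 0 1 * swap 2 3 * swap 1 2)
    (swap 0 1 * swap 1 2 * swap 2 3 * swap 1 2)
    (by decide) (by decide) (by decide)
  have h₆ := hL (swap 0 1 * swap 1 2) (swap 1 2 * swap 0 1)
    (swap 0 1 * swap 1 2 * swap 0 1)
    (swap 2 3 * swap 1 2 * swap 0 1)
    (swap 0 1 * swap 2 3 * swap 1 2 * swap 0 1)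
    (by decide) (by decide) (by decide)
  have h₇ := hL 1 (swap 2 3 * swap 1 2)
    (swap 2 3 * swap 1 2 * swap 0 1)
    (swap 1 2 * swap 2 3 * swap 1 2)
    (swap 1 2 * swap 2 3 * swap 1 2 * swap 0 1)
    (by decide) (by decide) (by decide)
  have h₈ := hL 1 (swap 0 1 * swap 1 2 * swap 0 1 * swap 2 3 * swap 1 2 * swap 0 1)
    (swap 0 1 * swap 1 2 * swap 0 1 * swap 2 3 * swap 1 2)
    (swap 1 2 * swap 0 1 * swap 2 3 * swap 1 2 * swap 0 1)
    (swap 1 2 * swap 0 1 * swap 2 3 * swap 1 2)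
    (by decide) (by decide) (by decide)
  have h₉ := hL 1 (swap 0 1 * swap 1 2 * swap 2 3 * swap 1 2)
    (swap 0 1 * swap 1 2 * swap 2 3 * swap 1 2 * swap 0 1)
    (swap 0 1 * swap 2 3 * swap 1 2)
    (swap 0 1 * swap 2 3 * swap 1 2 * swap 0 1)
    (by decide) (by decide) (by decide)
  linear_combination (1 / 2) * (h₁ + h₂ + h₃ + h₄ + h₅ + h₆ - h₇ - h₈ - h₉)

theorem not_isIntertwiner (U : Ambient → Matrix (Fin 4) (Fin 4) ℂ) : ¬ IsIntertwiner U := by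
  intro hU
  choose A hAc hA using hU.exists_log_entry
  obtain ⟨D, hDc, hD⟩ := hU.exists_log_det
  have h := congrArg Complex.exp (sum_even_eq_sum_odd_of_square
    fun π g _ _ _ => hU.signLog_square hAc hA hDc hD π g)
  simp only [Complex.exp_add, hU.exp_signLog hA hD, Perm.sign_mul, Perm.sign_one] at h
  rw [Perm.sign_swap (by decide : (0 : Fin 4) ≠ 1), Perm.sign_swap (by decide : (1 : Fin 4) ≠ 2)]
    at h
  norm_num at h

/-- The constant quadruple with value `r`, as a point of `carrier`. -/
def constPoint (r : Fin 4 → ℝ) (hr : ∀ k, r k ∈ Icc (0 : ℝ) 1) : carrier :=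
  ⟨_, const_mem_carrier hr⟩

theorem rearranged_mem_Icc {x : Ambient} (hx : x ∈ carrier) (i k : Fin 4) :
    rearranged x i k ∈ Icc (0 : ℝ) 1 := by
  obtain ⟨g, hg⟩ := exists_ne_zero_of_mem_carrier hx
  rw [rearranged_eq hx hg]
  exact hx.1 _ _

theorem constPoint_injective {r r' : Fin 4 → ℝ} {hr : ∀ k, r k ∈ Icc (0 : ℝ) 1}
    {hr' : ∀ k, r' k ∈ Icc (0 : ℝ) 1} (h : constPoint r hr = constPoint r' hr') : r = r' :=
  congrFun (congrArg (fun y : carrier => y.1.1) h) 0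

theorem continuous_constPoint {f : carrier → Fin 4 → ℝ} (hf : Continuous f)
    (h : ∀ x k, f x k ∈ Icc (0 : ℝ) 1) : Continuous fun x => constPoint (f x) (h x) :=
  Continuous.subtype_mk (by fun_prop) _


/-- there exist a nonempty compact metrizable space `X` and two 4-variable
dynamical systems `(X, σ)` and `(X, τ)` that are piecewise equivalent (there is an open
cover `{W_g}_{g ∈ S₄}` with `τ_i = σ_{g⁻¹(i)}` on `W_g`), yet admit no unitary
equivalence `u : X → U(4)`. -/
theorem exists_piecewise_equivalent_not_unitarily_equivalent :
    ∃ (X : Type) (tX : TopologicalSpace X),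
      @CompactSpace X tX ∧ @T2Space X tX ∧ @TopologicalSpace.MetrizableSpace X tX ∧
      Nonempty X ∧
      ∃ σ τ : Fin 4 → X → X,
        (∀ i, @Continuous X X tX tX (σ i)) ∧ (∀ i, @Continuous X X tX tX (τ i)) ∧
        (∃ W : Equiv.Perm (Fin 4) → Set X,
          (∀ g, @IsOpen X tX (W g)) ∧ (⋃ g, W g) = Set.univ ∧
          ∀ g, ∀ x ∈ W g, ∀ i : Fin 4, τ i x = σ (g⁻¹ i) x) ∧
        ¬ ∃ u : X → Matrix (Fin 4) (Fin 4) ℂ,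
            @Continuous X _ tX _ u ∧
            (∀ x, u x ∈ Matrix.unitaryGroup (Fin 4) ℂ) ∧
            ∀ x, ∀ i j : Fin 4, u x i j ≠ 0 → τ i x = σ j x := by
  have hre : ∀ i, Continuous fun x : carrier => rearranged x.1 i := by
    intro i
    unfold rearranged
    fun_prop
  refine ⟨carrier, inferInstance, isCompact_iff_compactSpace.1 isCompact_carrier, inferInstance,
    inferInstance, ⟨constPoint 0 (by simp)⟩,
    fun i x => constPoint (x.1.1 i) (x.2.1 i),
    fun i x => constPoint (rearranged x.1 i) (rearranged_mem_Icc x.2 i),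
    fun i => continuous_constPoint (by fun_prop) _, fun i => continuous_constPoint (hre i) _,
    ⟨fun g => {x | x.1.2 g ≠ 0}, fun g => isOpen_ne_fun (by fun_prop) continuous_const, ?_, ?_⟩, ?_⟩
  · exact eq_univ_of_forall fun x => mem_iUnion.2 (exists_ne_zero_of_mem_carrier x.2)
  · intro g x hx i
    exact Subtype.ext (by simp only [constPoint, rearranged_eq x.2 hx])
  · classical
    rintro ⟨u, hu, hunit, hmat⟩
    let U : Ambient → Matrix (Fin 4) (Fin 4) ℂ := fun x => if h : x ∈ carrier then u ⟨x, h⟩ else 0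
    have hUu : ∀ x : carrier, U x = u x := fun x => by simp [U]
    refine not_isIntertwiner U ⟨fun i j => ?_, fun x hx => ?_, fun x hx g hg i j hij => ?_⟩
    · rw [continuousOn_iff_continuous_domRestrict]
      have : carrier.domRestrict (fun x => U x i j) = fun x => u x i j := by
        ext x
        simp [hUu]
      rw [this]
      fun_prop
    · rw [hUu ⟨x, hx⟩]
      exact (Matrix.UnitaryGroup.det_isUnit ⟨u ⟨x, hx⟩, hunit ⟨x, hx⟩⟩).ne_zero
    · rw [hUu ⟨x, hx⟩] at hij
      rw [← rearranged_eq hx hg]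
      exact constPoint_injective (hmat ⟨x, hx⟩ i j hij)
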